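/- Let 0 < α < ∞ and let ω be a radial continuous weight on the unit disc that is either regular or rapidly increasing. Then there exists a constant C = C(α,ω) > 0 such that for every analytic function f on 𝔻 and every z ∈ 𝔻, |f(z)|^α ≤ C · M_ω(|f|^α)(z), where M_ω is the weighted (Hörmander) maximal function. -/

import Mathlib

open MeasureTheory Set Filter

noncomputable section

/-- `wInt ω r = ∫_r^1 ω(s) ds`. -/
def wInt (ω : ℝ → ℝ) (r : ℝ) : ℝ := ∫ s in r..1, ω s

/-- A radial weight on the unit disc, identified with a function on `[0,1)`:
positive and integrable. -/
def IsRadialWeight (ω : ℝ → ℝ) : Prop :=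
  (∀ r ∈ Set.Ico (0:ℝ) 1, 0 < ω r) ∧ IntegrableOn ω (Set.Ico (0:ℝ) 1)

/-- A radial continuous weight. -/
def IsRadialContinuousWeight (ω : ℝ → ℝ) : Prop :=
  IsRadialWeight ω ∧ ContinuousOn ω (Set.Ico (0:ℝ) 1)

/-- A regular weight: radial continuous with `ψ_ω(r) ≍ 1 - r`, i.e.
`(1-r)·ω(r) ≍ ∫_r^1 ω(s) ds` on `[0,1)`. -/
def IsRegularWeight (ω : ℝ → ℝ) : Prop :=
  IsRadialContinuousWeight ω ∧ ∃ c C : ℝ, 0 < c ∧ 0 < C ∧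
    ∀ r ∈ Set.Ico (0:ℝ) 1,
      c * ((1 - r) * ω r) ≤ wInt ω r ∧ wInt ω r ≤ C * ((1 - r) * ω r)

/-- A rapidly increasing weight: radial continuous with
`ψ_ω(r)/(1-r) = (∫_r^1 ω)/(ω(r)(1-r)) → ∞` as `r → 1⁻`. -/
def IsRapidlyIncreasing (ω : ℝ → ℝ) : Prop :=
  IsRadialContinuousWeight ω ∧
    Tendsto (fun r => wInt ω r / (ω r * (1 - r))) (nhdsWithin 1 (Set.Iio 1)) atTop

/-- The open unit disc in `ℂ`. -/
def unitDisc : Set ℂ := {z : ℂ | ‖z‖ < 1}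

/-- The Carleson square `S(I)` associated with the arc `I ⊂ 𝕋` with midpoint `e^{iθ}` and
arc length `h`: `S(I) = {re^{it} ∈ 𝔻 : e^{it} ∈ I, 1 - h ≤ r < 1}`. -/
def CBox (θ h : ℝ) : Set ℂ :=
  {z : ℂ | 1 - h ≤ ‖z‖ ∧ ‖z‖ < 1 ∧
    |Complex.arg (z * Complex.exp (-(θ : ℂ) * Complex.I))| ≤ h / 2}

/-- The weighted (Hörmander) maximal function
`M_ω(φ)(z) = sup_{I : z ∈ S(I)} (1/ω(S(I))) ∫_{S(I)} |φ| ω dA`, with values in `[0,∞]`. -/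
def MaxFn (ω : ℝ → ℝ) (φ : ℂ → ℝ) (z : ℂ) : ENNReal :=
  ⨆ (θ : ℝ) (h : ℝ) (_ : 0 < h ∧ h ≤ 2 * Real.pi ∧ z ∈ CBox θ h),
    (∫⁻ ξ in CBox θ h, ENNReal.ofReal (|φ ξ| * ω ‖ξ‖)) /
      (∫⁻ ξ in CBox θ h, ENNReal.ofReal (ω ‖ξ‖))

/-- A canonical factor has modulus at least one inside its disc, away from its pole. -/
lemma one_le_norm_canonicalFactor {R : ℝ} {u w : ℂ} (hu : ‖u‖ < R) (hw : ‖w‖ ≤ R) (huw : w ≠ u) :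
    1 ≤ ‖Complex.canonicalFactor R u w‖ := by
  have hR : 0 < R := (norm_nonneg u).trans_lt hu
  have hne : 0 < ‖(R : ℂ) * (w - u)‖ := norm_pos_iff.2 (mul_ne_zero (by exact_mod_cast hR.ne')
    (sub_ne_zero.2 huw))
  rw [Complex.canonicalFactor_apply, norm_div, one_le_div hne]
  refine le_of_sq_le_sq ?_ (norm_nonneg _)
  have h1 : ‖u‖ ^ 2 ≤ R ^ 2 := by gcongr
  have h2 : ‖w‖ ^ 2 ≤ R ^ 2 := by gcongr
  rw [← Complex.normSq_eq_norm_sq, Complex.normSq_apply] at h1 h2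
  rw [← Complex.normSq_eq_norm_sq, ← Complex.normSq_eq_norm_sq, Complex.normSq_apply,
    Complex.normSq_apply]
  simp only [Complex.mul_re, Complex.mul_im, Complex.ofReal_re, Complex.ofReal_im, Complex.sub_re,
    Complex.sub_im, Complex.conj_re, Complex.conj_im, ← Complex.ofReal_pow]
  nlinarith [mul_nonneg (sub_nonneg.2 h1) (sub_nonneg.2 h2)]

open MeromorphicOn in
/-- Dividing out the zeros of an analytic function: if `f` has no zeros on the boundary of a disc,
then there is a zero-free analytic function dominating `f` in the disc, with equal modulus on the
boundary. -/
lemma exists_zero_free_majorant {R : ℝ} (hR : 0 < R) {f : ℂ → ℂ}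
    (hf : AnalyticOnNhd ℂ f (Metric.closedBall 0 R)) (h0 : ∀ u ∈ Metric.sphere (0 : ℂ) R, f u ≠ 0) :
    ∃ h : ℂ → ℂ, AnalyticOnNhd ℂ h (Metric.closedBall 0 R) ∧
      (∀ u ∈ Metric.closedBall (0 : ℂ) R, h u ≠ 0) ∧
      (∀ u ∈ Metric.closedBall (0 : ℂ) R, ‖f u‖ ≤ ‖h u‖) ∧
      ∀ u ∈ Metric.sphere (0 : ℂ) R, ‖h u‖ = ‖f u‖ := by
  have hp : (R : ℂ) ∈ Metric.sphere (0 : ℂ) R := by simp [abs_of_pos hR]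
  have hpre : IsPreconnected (Metric.closedBall (0 : ℂ) R) :=
    (convex_closedBall (0 : ℂ) R).isPreconnected
  have hord (u : ℂ) (hu : u ∈ Metric.closedBall (0 : ℂ) R) : meromorphicOrderAt f u ≠ ⊤ := by
    refine hf.meromorphicOn.meromorphicOrderAt_ne_top_of_isPreconnected hpre
      (Metric.sphere_subset_closedBall hp) hu ?_
    rw [(hf _ (Metric.sphere_subset_closedBall hp)).meromorphicNFAt.meromorphicOrderAt_eq_zero_iff.2
      (h0 _ hp)]
    simp
  obtain ⟨h, D⟩ := hf.meromorphicOn.exists_ecanonicalDecomp (fun u => hord u u.2)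
  have hs (i : ℂ) : divisor f (Metric.sphere 0 R) i = 0 := by
    by_cases hi : i ∈ Metric.sphere (0 : ℂ) R
    · rw [divisor_apply (hf.meromorphicOn.mono_set Metric.sphere_subset_closedBall) hi,
        (hf _ (Metric.sphere_subset_closedBall hi)).meromorphicNFAt.meromorphicOrderAt_eq_zero_iff.2
          (h0 _ hi)]
      simp
    · exact Function.locallyFinsuppWithin.apply_eq_zero_of_notMem _ hi
  have key (w : ℂ) (hw : w ∈ Metric.closedBall (0 : ℂ) R) (hfw : f w ≠ 0) :
      Real.log ‖h w‖ = (∑ᶠ i, (divisor f (Metric.ball 0 R) i) *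
        Real.log ‖Complex.canonicalFactor R i w‖) + Real.log ‖f w‖ := by
    rw [D.log_norm_eq hw ((hf _ hw).meromorphicNFAt.meromorphicOrderAt_eq_zero_iff.2 hfw) hR,
      (hf w hw).meromorphicTrailingCoeffAt_of_ne_zero hfw]
    simp [hs]
  refine ⟨h, D.analyticOnNhd, D.ne_zero, fun w hw => ?_, fun w hw => ?_⟩
  · by_cases hfw : f w = 0
    · simp [hfw]
    rw [← Real.log_le_log_iff (norm_pos_iff.2 hfw) (norm_pos_iff.2 (D.ne_zero w hw)),
      key w hw hfw, le_add_iff_nonneg_left]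
    refine finsum_nonneg fun i => ?_
    by_cases hi : i ∈ Metric.ball (0 : ℂ) R
    · have hdiv := (hf.mono Metric.ball_subset_closedBall).divisor_nonneg i
      rw [divisor_apply (hf.meromorphicOn.mono_set Metric.ball_subset_closedBall) hi] at *
      by_cases hiw : w = i
      · subst hiw; simp
      · exact mul_nonneg (by exact_mod_cast hdiv)
          (Real.log_nonneg (one_le_norm_canonicalFactor (by simpa using hi) (by simpa using hw) hiw))
    · rw [Function.locallyFinsuppWithin.apply_eq_zero_of_notMem _ hi]; simp
  · have hw' := Metric.sphere_subset_closedBall hw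
    have hlog : Real.log ‖h w‖ = Real.log ‖f w‖ := by
      rw [key w hw' (h0 w hw), add_eq_right]
      refine finsum_eq_zero_of_forall_eq_zero fun i => ?_
      by_cases hi : i ∈ Metric.ball (0 : ℂ) R
      · rw [Complex.norm_canonicalFactor_eval_circle_eq_one hi hw]; simp
      · rw [Function.locallyFinsuppWithin.apply_eq_zero_of_notMem _ hi]; simp
    exact Real.log_injOn_pos (norm_pos_iff.2 (D.ne_zero w hw')) (norm_pos_iff.2 (h0 w hw)) hlog

/-- The modulus power of a zero-free analytic function is the modulus of an analytic function. -/
lemma exists_norm_eq_rpow {R : ℝ} (hR : 0 < R) {h : ℂ → ℂ} (α : ℝ)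
    (hh : AnalyticOnNhd ℂ h (Metric.closedBall 0 R))
    (h0 : ∀ u ∈ Metric.closedBall (0 : ℂ) R, h u ≠ 0) :
    ∃ F : ℂ → ℂ, AnalyticOnNhd ℂ F (Metric.closedBall 0 R) ∧
      ∀ u ∈ Metric.closedBall (0 : ℂ) R, ‖F u‖ = ‖h u‖ ^ α := by
  have hharm : ∀ x ∈ Metric.closedBall (0 : ℂ) R,
      InnerProductSpace.HarmonicAt (fun z => Real.log ‖h z‖) x :=
    fun x hx => (hh x hx).harmonicAt_log_norm (h0 x hx)
  obtain ⟨e, he, hsub⟩ := (isCompact_closedBall (0 : ℂ) R).exists_thickening_subset_open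
    (InnerProductSpace.isOpen_setOfPred_harmonicAt (fun z => Real.log ‖h z‖)) hharm
  rw [thickening_closedBall he hR.le] at hsub
  obtain ⟨F, hF, hre⟩ :=
    InnerProductSpace.HarmonicOnNhd.exists_analyticOnNhd_ball_re_eq (f := fun z => Real.log ‖h z‖)
      (z := 0) (R := e + R) (fun x hx => hsub hx)
  have hcb : Metric.closedBall (0 : ℂ) R ⊆ Metric.ball 0 (e + R) :=
    Metric.closedBall_subset_ball (by linarith)
  refine ⟨fun u => Complex.exp (α * F u), fun u hu => ?_, fun u hu => ?_⟩
  · have := hF u (hcb hu)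
    fun_prop
  · have := hre (hcb hu)
    simp only at this
    rw [Complex.norm_exp, Complex.re_ofReal_mul, this, mul_comm,
      Real.rpow_def_of_pos (norm_pos_iff.2 (h0 u hu))]

open ComplexConjugate in
/-- Subharmonicity of `|f|^α`, with a Poisson kernel improved by a power `N`. -/
lemma rpow_norm_le_circleAverage {R : ℝ} (hR : 0 < R) {f : ℂ → ℂ} {α : ℝ} (hα : 0 < α) (N : ℕ)
    (hf : AnalyticOnNhd ℂ f (Metric.closedBall 0 R)) (h0 : ∀ u ∈ Metric.sphere (0 : ℂ) R, f u ≠ 0)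
    {w : ℂ} (hw : w ∈ Metric.ball (0 : ℂ) R) :
    ‖f w‖ ^ α ≤ Real.circleAverage (fun ζ => ‖f ζ‖ ^ α *
      ((R ^ 2 - ‖w‖ ^ 2) ^ (N + 1) / (R ^ N * ‖ζ - w‖ ^ (N + 2)))) 0 R := by
  obtain ⟨h, hh, hh0, hle, heq⟩ := exists_zero_free_majorant hR hf h0
  obtain ⟨F, hF, hFn⟩ := exists_norm_eq_rpow hR α hh hh0
  have hwR : ‖w‖ < R := by simpa using hw
  have hwc := Metric.ball_subset_closedBall hw
  have hden (ζ : ℂ) (hζ : ζ ∈ Metric.closedBall (0 : ℂ) R) : (R : ℂ) ^ 2 - conj w * ζ ≠ 0 := by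
    intro hz
    have h1 : ‖(R : ℂ) ^ 2‖ = ‖conj w * ζ‖ := by rw [sub_eq_zero.1 hz]
    simp only [norm_pow, Complex.norm_real, Real.norm_eq_abs, sq_abs, norm_mul, RCLike.norm_conj] at h1
    have h2 : ‖ζ‖ ≤ R := by simpa using hζ
    nlinarith [norm_nonneg ζ, norm_nonneg w]
  set G : ℂ → ℂ := fun ζ => F ζ * (((R : ℂ) ^ 2 - conj w * w) / ((R : ℂ) ^ 2 - conj w * ζ)) ^ N
  have hG : AnalyticOnNhd ℂ G (Metric.closedBall 0 R) := by
    intro ζ hζ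
    have h1 := hF ζ hζ
    have h2 := hden ζ hζ
    fun_prop (disch := assumption)
  have hGw : ‖f w‖ ^ α ≤ ‖G w‖ := by
    simp only [G]
    rw [div_self (hden w hwc), one_pow, mul_one, hFn w hwc]
    exact Real.rpow_le_rpow (norm_nonneg _) (hle w hwc) hα.le
  have hGd : DiffContOnCl ℂ G (Metric.ball 0 R) := by
    apply DifferentiableOn.diffContOnCl
    rw [closure_ball _ hR.ne']
    exact hG.differentiableOn
  have hP := hGd.circleAverage_poissonKernel_smul' hw
  refine hGw.trans ?_
  rw [← hP]
  simp only [Real.circleAverage_def, norm_smul]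
  rw [Real.norm_of_nonneg (by positivity), smul_eq_mul]
  gcongr
  refine (intervalIntegral.norm_integral_le_integral_norm (by positivity)).trans_eq ?_
  refine intervalIntegral.integral_congr fun θ _ => ?_
  have hζ : circleMap 0 R θ ∈ Metric.sphere (0 : ℂ) R := circleMap_mem_sphere _ hR.le _
  generalize circleMap 0 R θ = ζ at hζ
  have hζc := Metric.sphere_subset_closedBall hζ
  have hζn : ‖ζ‖ = R := by simpa using hζ
  have hd : ‖(R : ℂ) ^ 2 - conj w * ζ‖ = R * ‖ζ - w‖ := by
    have : (R : ℂ) ^ 2 - conj w * ζ = conj (ζ - w) * ζ := by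
      rw [← hζn, ← Complex.conj_mul', map_sub]; ring
    rw [this, norm_mul, RCLike.norm_conj, hζn, mul_comm]
  have hn : ‖(R : ℂ) ^ 2 - conj w * w‖ = R ^ 2 - ‖w‖ ^ 2 := by
    rw [Complex.conj_mul', ← Complex.ofReal_pow, ← Complex.ofReal_pow, ← Complex.ofReal_sub,
      Complex.norm_real, Real.norm_of_nonneg]
    nlinarith [norm_nonneg w]
  have hzw : 0 < ‖ζ - w‖ := by
    refine norm_pos_iff.2 (sub_ne_zero.2 ?_)
    rintro rfl; linarith
  have hpos : 0 ≤ R ^ 2 - ‖w‖ ^ 2 := by nlinarith [norm_nonneg w]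
  simp only [G, sub_zero]
  rw [hζn, norm_smul, Real.norm_of_nonneg (by positivity), norm_mul, norm_pow, norm_div, hd, hn,
    hFn ζ hζc, heq ζ hζ, div_pow, mul_pow]
  field_simp
  ring

section Weights

variable {ω : ℝ → ℝ}

lemma IsRadialWeight.intervalIntegrable (h : IsRadialWeight ω) {a b : ℝ} (ha : 0 ≤ a) (hab : a ≤ b)
    (hb : b ≤ 1) : IntervalIntegrable ω volume a b := by
  rw [intervalIntegrable_iff_integrableOn_Ico_of_le hab]
  exact h.2.mono_set (Ico_subset_Ico ha hb)

lemma IsRadialWeight.wInt_pos (h : IsRadialWeight ω) {r : ℝ} (hr : r ∈ Ico (0 : ℝ) 1) :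
    0 < wInt ω r :=
  intervalIntegral.intervalIntegral_pos_of_pos_on (h.intervalIntegrable hr.1 hr.2.le le_rfl)
    (fun x hx => h.1 x ⟨hr.1.trans hx.1.le, hx.2⟩) hr.2

lemma IsRadialWeight.wInt_eq (h : IsRadialWeight ω) {r : ℝ} (hr : r ∈ Ico (0 : ℝ) 1) :
    wInt ω r = wInt ω 0 - ∫ s in (0 : ℝ)..r, ω s := by
  rw [wInt, wInt, eq_sub_iff_add_eq', intervalIntegral.integral_add_adjacent_intervals
    (h.intervalIntegrable le_rfl hr.1 hr.2.le) (h.intervalIntegrable hr.1 hr.2.le le_rfl)]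

lemma IsRadialWeight.continuousOn_wInt (h : IsRadialWeight ω) :
    ContinuousOn (wInt ω) (Ico (0 : ℝ) 1) := by
  refine ContinuousOn.congr (f := fun r => wInt ω 0 - ∫ s in (0 : ℝ)..r, ω s) ?_
    fun r hr => h.wInt_eq hr
  refine continuousOn_const.sub (ContinuousOn.mono (s := uIcc 0 1) ?_ ?_)
  · refine intervalIntegral.continuousOn_primitive_interval ?_
    rw [uIcc_of_le zero_le_one, integrableOn_Icc_iff_integrableOn_Ico]
    exact h.2
  · rw [uIcc_of_le zero_le_one]; exact Ico_subset_Icc_self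

lemma IsRadialContinuousWeight.hasDerivAt_wInt (h : IsRadialContinuousWeight ω) {r : ℝ}
    (hr : r ∈ Ioo (0 : ℝ) 1) : HasDerivAt (wInt ω) (-ω r) r := by
  have hnhds : Ioo (0 : ℝ) 1 ∈ nhds r := Ioo_mem_nhds hr.1 hr.2
  have hc : ContinuousOn ω (Ioo (0 : ℝ) 1) := h.2.mono Ioo_subset_Ico_self
  refine HasDerivAt.congr_of_eventuallyEq (f := fun r => wInt ω 0 - ∫ s in (0 : ℝ)..r, ω s) ?_
    (by filter_upwards [hnhds] with x hx using h.1.wInt_eq (Ioo_subset_Ico_self hx))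
  refine (intervalIntegral.integral_hasDerivAt_right
    (h.1.intervalIntegrable le_rfl hr.1.le hr.2.le) ?_ (hc.continuousAt hnhds)).const_sub _
  exact hc.stronglyMeasurableAtFilter isOpen_Ioo r hr

/-- Regular and rapidly increasing weights both satisfy a lower bound for the distortion
function. -/
lemma exists_mul_le_wInt (hω : IsRegularWeight ω ∨ IsRapidlyIncreasing ω) :
    IsRadialContinuousWeight ω ∧ ∃ c : ℝ, 0 < c ∧
      ∀ r ∈ Ico (0 : ℝ) 1, c * ((1 - r) * ω r) ≤ wInt ω r := by
  rcases hω with ⟨h, c, C, hc, -, hcC⟩ | ⟨h, ht⟩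
  · exact ⟨h, c, hc, fun r hr => (hcC r hr).1⟩
  refine ⟨h, ?_⟩
  have hev := ht.eventually_ge_atTop 1
  rw [eventually_nhdsWithin_iff] at hev
  obtain ⟨l, hl, hl'⟩ := (Metric.eventually_nhds_iff_ball.1 hev)
  set s : ℝ := max 0 (1 - l / 2)
  have hs0 : 0 ≤ s := le_max_left _ _
  have hs1 : s < 1 := max_lt one_pos (by linarith)
  have hsub : Icc 0 s ⊆ Ico (0 : ℝ) 1 := fun x hx => ⟨hx.1, hx.2.trans_lt hs1⟩
  have hpos (r : ℝ) (hr : r ∈ Ico (0 : ℝ) 1) : 0 < ω r * (1 - r) :=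
    mul_pos (h.1.1 r hr) (sub_pos.2 hr.2)
  have hcont : ContinuousOn (fun r => wInt ω r / (ω r * (1 - r))) (Icc 0 s) := by
    refine (h.1.continuousOn_wInt.mono hsub).div ((h.2.mono hsub).mul (by fun_prop)) ?_
    exact fun x hx => (hpos x (hsub hx)).ne'
  obtain ⟨x, hx, hmin⟩ := isCompact_Icc.exists_isMinOn (nonempty_Icc.2 hs0) hcont
  refine ⟨min 1 (wInt ω x / (ω x * (1 - x))), lt_min one_pos
    (div_pos (h.1.wInt_pos (hsub hx)) (hpos x (hsub hx))), fun r hr => ?_⟩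
  rw [mul_comm (1 - r), ← le_div_iff₀ (hpos r hr)]
  by_cases hrs : r ≤ s
  · exact (min_le_right _ _).trans (hmin ⟨hr.1, hrs⟩)
  · refine (min_le_left _ _).trans (hl' r ?_ hr.2)
    have : 1 - l / 2 < r := (le_max_right _ _).trans_lt (not_le.1 hrs)
    rw [Metric.mem_ball, Real.dist_eq, abs_lt]
    constructor <;> linarith [hr.2]

/-- Polynomial form of the doubling property of `wInt ω`. -/
lemma exists_wInt_mul_pow_le (hω : IsRegularWeight ω ∨ IsRapidlyIncreasing ω) :
    ∃ p : ℕ, ∀ u s : ℝ, 0 ≤ u → u ≤ s → s < 1 →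
      wInt ω u * (1 - s) ^ p ≤ wInt ω s * (1 - u) ^ p := by
  obtain ⟨h, c, hc, hle⟩ := exists_mul_le_wInt hω
  obtain ⟨p, hp⟩ := exists_nat_ge (1 / c)
  refine ⟨p, fun u s hu hus hs => ?_⟩
  have hmono : MonotoneOn (fun r => wInt ω r / (1 - r) ^ p) (Ico (0 : ℝ) 1) := by
    have hd (x : ℝ) (hx : x ∈ Ioo (0 : ℝ) 1) : HasDerivAt (fun r => wInt ω r / (1 - r) ^ p)
        ((-ω x * (1 - x) ^ p - wInt ω x * (p * (1 - x) ^ (p - 1) * (-1))) / ((1 - x) ^ p) ^ 2) x :=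
      (h.hasDerivAt_wInt hx).div (((hasDerivAt_id x).const_sub 1).pow p)
        (pow_pos (sub_pos.2 hx.2) p).ne'
    refine monotoneOn_of_deriv_nonneg (convex_Ico 0 1) ?_ ?_ ?_
    · exact h.1.continuousOn_wInt.div (by fun_prop) fun x hx => (pow_pos (sub_pos.2 hx.2) p).ne'
    · rw [interior_Ico]
      exact fun x hx => (hd x hx).differentiableAt.differentiableWithinAt
    · rw [interior_Ico]
      intro x hx
      rw [(hd x hx).deriv]
      have hx1 : 0 < 1 - x := sub_pos.2 hx.2
      have hW := h.1.wInt_pos (Ioo_subset_Ico_self hx)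
      have h1 : (1 - x) * ω x ≤ p * wInt ω x := by
        have := hle x (Ioo_subset_Ico_self hx)
        calc (1 - x) * ω x = 1 / c * (c * ((1 - x) * ω x)) := by field_simp
          _ ≤ p * wInt ω x := by
            have := mul_pos hx1 (h.1.1 x (Ioo_subset_Ico_self hx))
            gcongr
      have hp0 : p ≠ 0 := by
        rintro rfl
        have : 0 < 1 / c := by positivity
        simp at hp; linarith
      obtain ⟨q, rfl⟩ := Nat.exists_eq_succ_of_ne_zero hp0
      refine div_nonneg ?_ (by positivity)
      have := mul_nonneg (sub_nonneg.2 h1) (pow_nonneg hx1.le q)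
      simp only [Nat.succ_eq_add_one, Nat.add_sub_cancel, pow_succ] at this ⊢
      nlinarith
  have := hmono ⟨hu, hus.trans_lt hs⟩ ⟨hu.trans hus, hs⟩ hus
  simp only at this
  rwa [div_le_div_iff₀ (pow_pos (by linarith) p) (pow_pos (by linarith) p)] at this

lemma IsRadialWeight.lintegral_Ioo_eq (h : IsRadialWeight ω) {r : ℝ} (hr : r ∈ Ico (0 : ℝ) 1) :
    ∫⁻ x in Ioo r 1, ENNReal.ofReal (ω x) = ENNReal.ofReal (wInt ω r) := by
  rw [wInt, intervalIntegral.integral_of_le hr.2.le, integral_Ioc_eq_integral_Ioo,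
    ofReal_integral_eq_lintegral_ofReal]
  · exact h.2.mono_set fun x hx => ⟨hr.1.trans hx.1.le, hx.2⟩
  · filter_upwards [ae_restrict_mem measurableSet_Ioo] with x hx
    exact (h.1 x ⟨hr.1.trans hx.1.le, hx.2⟩).le

end Weights

lemma measurableSet_CBox (θ h : ℝ) : MeasurableSet (CBox θ h) := by
  have harg : Measurable fun z : ℂ => |Complex.arg (z * Complex.exp (-(θ : ℂ) * Complex.I))| :=
    continuous_abs.measurable.comp (Complex.measurable_arg.comp (measurable_id.mul_const _))
  have h1 : MeasurableSet {z : ℂ | 1 - h ≤ ‖z‖} := measurableSet_le measurable_const measurable_norm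
  have h2 : MeasurableSet {z : ℂ | ‖z‖ < 1} := measurableSet_lt measurable_norm measurable_const
  exact h1.inter (h2.inter (measurableSet_le harg measurable_const))

lemma lintegral_eq_lintegral_circleMap {g : ℂ → ENNReal} (hg : Measurable g) :
    ∫⁻ ζ, g ζ = ∫⁻ ρ in Ioi (0 : ℝ), ∫⁻ t in Ioo (-Real.pi) Real.pi,
      ENNReal.ofReal ρ * g (circleMap 0 ρ t) := by
  have hm : Measurable (fun p : ℝ × ℝ => circleMap 0 p.1 p.2) := by
    unfold circleMap; fun_prop
  rw [← Complex.lintegral_comp_polarCoord_symm, polarCoord_target, Measure.volume_eq_prod,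
    ← Measure.prod_restrict, ← lintegral_prod
      (f := fun p : ℝ × ℝ => ENNReal.ofReal p.1 * g (circleMap 0 p.1 p.2))]
  · refine lintegral_congr fun p => ?_
    rw [smul_eq_mul, Complex.polarCoord_symm_apply, circleMap_zero, Complex.exp_mul_I,
      Complex.ofReal_cos, Complex.ofReal_sin]
  · exact (ENNReal.measurable_ofReal.comp measurable_fst).mul (hg.comp hm) |>.aemeasurable

lemma norm_circleMap_of_pos {ρ : ℝ} (hρ : 0 < ρ) (t : ℝ) : ‖circleMap 0 ρ t‖ = ρ := by
  rw [norm_circleMap_zero, abs_of_pos hρ]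

lemma setLIntegral_CBox_eq {W : ℝ → ENNReal} (θ h : ℝ) :
    ∫⁻ ξ in CBox θ h, W ‖ξ‖ = ∫⁻ ξ in CBox 0 h, W ‖ξ‖ := by
  set R := rotation (Circle.exp (-θ))
  have hR (ξ : ℂ) : R ξ = ξ * Complex.exp (-(θ : ℂ) * Complex.I) := by
    rw [rotation_apply, Circle.coe_exp, mul_comm, Complex.ofReal_neg]
  have hpre : R ⁻¹' CBox 0 h = CBox θ h := by
    ext ξ
    simp only [CBox, mem_preimage, mem_ofPred_eq, R.norm_map, Complex.ofReal_zero, neg_zero,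
      zero_mul, Complex.exp_zero, mul_one]
    rw [hR]
  have key := R.measurePreserving.setLIntegral_comp_preimage_emb
    R.toMeasurableEquiv.measurableEmbedding (fun ξ => W ‖ξ‖) (CBox 0 h)
  rw [hpre] at key
  simpa only [R.norm_map] using key

/-- The weighted area of a Carleson square is at most its arc length times the radial mass. -/
lemma setLIntegral_CBox_le {ω : ℝ → ℝ} {W : ℝ → ENNReal} (hW : Measurable W)
    (hWω : ∀ x ∈ Ioo (0 : ℝ) 1, W x = ENNReal.ofReal (ω x)) (θ : ℝ) {h s : ℝ}
    (hs : s = max 0 (1 - h)) :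
    ∫⁻ ξ in CBox θ h, W ‖ξ‖ ≤ ENNReal.ofReal h * ∫⁻ x in Ioo s 1, ENNReal.ofReal (ω x) := by
  rw [setLIntegral_CBox_eq, ← lintegral_indicator (measurableSet_CBox 0 h)]
  change ∫⁻ ζ, (CBox 0 h).indicator (W ∘ norm) ζ ≤ _
  rw [lintegral_eq_lintegral_circleMap
      ((hW.comp measurable_norm).indicator (measurableSet_CBox 0 h))]
  have hle (ρ : ℝ) (hρ : ρ ∈ Ioi (0 : ℝ)) :
      ∫⁻ t in Ioo (-Real.pi) Real.pi, ENNReal.ofReal ρ *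
        (CBox 0 h).indicator (W ∘ norm) (circleMap 0 ρ t) ≤
      ENNReal.ofReal h * (Ico s 1).indicator W ρ := by
    have hpt (t : ℝ) (ht : t ∈ Ioo (-Real.pi) Real.pi) : ENNReal.ofReal ρ *
        (CBox 0 h).indicator (W ∘ norm) (circleMap 0 ρ t) ≤
        (Icc (-(h / 2)) (h / 2)).indicator (fun _ => (Ico s 1).indicator W ρ) t := by
      by_cases hm : circleMap 0 ρ t ∈ CBox 0 h
      · have harg : Complex.arg (circleMap 0 ρ t) = t := by
          rw [circleMap_zero, Complex.exp_mul_I]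
          exact Complex.arg_mul_cos_add_sin_mul_I hρ ⟨ht.1, ht.2.le⟩
        have h1 := hm.1
        have h2 := hm.2.1
        have h3 := hm.2.2
        simp only [Complex.ofReal_zero, neg_zero, zero_mul, Complex.exp_zero, mul_one, harg] at h3
        rw [norm_circleMap_of_pos hρ] at h1 h2
        have ht' : t ∈ Icc (-(h / 2)) (h / 2) := abs_le.1 h3
        have hρ' : ρ ∈ Ico s 1 := ⟨hs ▸ max_le (le_of_lt hρ) h1, h2⟩
        rw [indicator_of_mem hm, indicator_of_mem ht', indicator_of_mem hρ', Function.comp_apply,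
          norm_circleMap_of_pos hρ]
        exact mul_le_of_le_one_left (by positivity) (ENNReal.ofReal_le_one.2 h2.le)
      · rw [indicator_of_notMem hm]; simp
    refine (setLIntegral_mono' measurableSet_Ioo hpt).trans
      ((lintegral_mono' Measure.restrict_le_self le_rfl).trans_eq ?_)
    rw [lintegral_indicator measurableSet_Icc, setLIntegral_const, Real.volume_Icc, mul_comm]
    congr 2; ring
  refine (setLIntegral_mono' measurableSet_Ioi hle).trans ?_
  rw [lintegral_const_mul _ (hW.indicator measurableSet_Ico)]
  refine mul_le_mul' le_rfl ?_
  refine (lintegral_mono' Measure.restrict_le_self le_rfl).trans ?_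
  rw [lintegral_indicator measurableSet_Ico, ← restrict_Ioo_eq_restrict_Ico]
  refine setLIntegral_mono' measurableSet_Ioo fun x hx => (hWω x ⟨?_, hx.2⟩).le
  exact (hs ▸ le_max_left 0 (1 - h) : (0 : ℝ) ≤ s).trans_lt hx.1

/-- Every point near the boundary lies in a dilated Carleson square based at `z`, of size
comparable to its distance from `z`. -/
lemma exists_mem_CBox {z ζ : ℂ} (hz : ‖z‖ < 1) (h1 : (1 + ‖z‖) / 2 < ‖ζ‖) (h2 : ‖ζ‖ < 1) :
    ∃ n : ℕ, ζ ∈ CBox z.arg (min (2 ^ n * (1 - ‖z‖)) (2 * Real.pi)) ∧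
      (1 - ‖z‖) / ‖ζ - z‖ ≤ 8 * Real.pi / 2 ^ n := by
  set a := 1 - ‖z‖ with ha
  have ha0 : 0 < a := by linarith
  have hπ := Real.pi_gt_three
  set v := ζ * Complex.exp (-(z.arg : ℂ) * Complex.I) with hv
  set τ := |Complex.arg v| with hτ
  have hexp : ‖Complex.exp (-(z.arg : ℂ) * Complex.I)‖ = 1 := by
    rw [← Complex.ofReal_neg, Complex.norm_exp_ofReal_mul_I]
  have hvn : ‖v‖ = ‖ζ‖ := by rw [hv, norm_mul, hexp, mul_one]
  have hvz : ‖v - ‖z‖‖ = ‖ζ - z‖ := by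
    have : v - ‖z‖ = (ζ - z) * Complex.exp (-(z.arg : ℂ) * Complex.I) := by
      have hh : (‖z‖ : ℂ) = z * Complex.exp (-(z.arg : ℂ) * Complex.I) := by
        calc (‖z‖ : ℂ) = ‖z‖ * Complex.exp (z.arg * Complex.I) *
              Complex.exp (-(z.arg : ℂ) * Complex.I) := by
              rw [mul_assoc, ← Complex.exp_add]; simp
          _ = _ := by rw [Complex.norm_mul_exp_arg_mul_I]
      rw [hh]; ring
    rw [this, norm_mul, hexp, mul_one]
  have hd1 : a / 2 ≤ ‖ζ - z‖ := by
    have := norm_sub_norm_le ζ z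
    linarith
  have hζ0 : 0 < ‖ζ‖ := by linarith [norm_nonneg z]
  have hd2 : τ ≤ 2 * Real.pi * ‖ζ - z‖ := by
    have hu : ‖v / ‖ζ‖‖ = 1 := by
      rw [norm_div, hvn, Complex.norm_real, norm_norm, div_self hζ0.ne']
    have hne : v / ‖ζ‖ ≠ 0 := by rw [← norm_ne_zero_iff, hu]; exact one_ne_zero
    have hang := Complex.angle_le_mul_norm_sub hu (norm_one (α := ℂ))
    rw [Complex.angle_one_right hne, div_eq_mul_inv, ← Complex.ofReal_inv,
      Complex.arg_mul_real (inv_pos.2 hζ0)] at hang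
    have h3 : v * ((‖ζ‖⁻¹ : ℝ) : ℂ) - 1 = (v - ‖ζ‖) / ‖ζ‖ := by
      have : (‖ζ‖ : ℂ) ≠ 0 := by exact_mod_cast hζ0.ne'
      push_cast; field_simp
    have h4 : ‖v - ‖ζ‖‖ ≤ 2 * ‖ζ - z‖ := by
      calc ‖v - ‖ζ‖‖ = ‖(v - ‖z‖) + ((‖z‖ - ‖ζ‖ : ℝ) : ℂ)‖ := by push_cast; congr 1; ring
        _ ≤ ‖v - ‖z‖‖ + ‖((‖z‖ - ‖ζ‖ : ℝ) : ℂ)‖ := norm_add_le _ _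
        _ ≤ ‖ζ - z‖ + ‖ζ - z‖ := by
          rw [hvz, Complex.norm_real, Real.norm_eq_abs]
          gcongr
          rw [norm_sub_rev]
          exact abs_norm_sub_norm_le z ζ
        _ = _ := by ring
    have h5 : ‖(v - ‖ζ‖) / ‖ζ‖‖ ≤ 4 * ‖ζ - z‖ := by
      rw [norm_div, Complex.norm_real, norm_norm, div_le_iff₀ hζ0]
      nlinarith [norm_nonneg (ζ - z), norm_nonneg z]
    rw [h3] at hang
    calc τ ≤ Real.pi / 2 * ‖(v - ‖ζ‖) / ‖ζ‖‖ := hang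
      _ ≤ Real.pi / 2 * (4 * ‖ζ - z‖) := by gcongr
      _ = _ := by ring
  have hex : ∃ n : ℕ, τ ≤ 2 ^ n * a / 2 := by
    obtain ⟨n, hn⟩ := pow_unbounded_of_one_lt (2 * τ / a) (one_lt_two)
    refine ⟨n, ?_⟩
    rw [div_lt_iff₀ ha0] at hn
    linarith
  classical
  refine ⟨Nat.find hex, ⟨?_, h2, ?_⟩, ?_⟩
  · have : a ≤ min (2 ^ Nat.find hex * a) (2 * Real.pi) :=
      le_min (le_mul_of_one_le_left ha0.le (one_le_pow₀ one_le_two)) (by linarith [norm_nonneg z])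
    linarith
  · rw [le_div_iff₀ two_pos]
    have hπτ := Complex.abs_arg_le_pi v
    have := Nat.find_spec hex
    exact le_min (by linarith) (by linarith)
  · have hd0 : 0 < ‖ζ - z‖ := by linarith
    rw [div_le_div_iff₀ hd0 (by positivity)]
    rcases Nat.eq_zero_or_pos (Nat.find hex) with h0 | h0
    · rw [h0]; nlinarith
    · have hlt := not_le.1 (Nat.find_min hex (Nat.sub_lt h0 one_pos))
      have hpow : (2 : ℝ) ^ Nat.find hex = 2 * 2 ^ (Nat.find hex - 1) := by
        rw [← pow_succ', Nat.sub_add_cancel h0]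
      rw [hpow]
      nlinarith

lemma countable_norm_image_zeros {f : ℂ → ℂ} (hf : DifferentiableOn ℂ f unitDisc) {z : ℂ}
    (hz : z ∈ unitDisc) (hfz : f z ≠ 0) : (norm '' ((f ⁻¹' {0}) ∩ unitDisc)).Countable := by
  have hball : unitDisc = Metric.ball (0 : ℂ) 1 := by ext; simp [unitDisc]
  rw [hball] at hf hz ⊢
  have hU : IsConnected (Metric.ball (0 : ℂ) 1) :=
    ⟨⟨z, hz⟩, (convex_ball (0 : ℂ) 1).isPreconnected⟩
  refine Countable.image ((HereditarilyLindelofSpace.isLindelof _).countable_of_isDiscrete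
    (isDiscrete_of_codiscreteWithin ?_)) _
  exact (hf.analyticOnNhd Metric.isOpen_ball).preimage_zero_mem_codiscreteWithin hfz hz hU

lemma kernel_le {z ζ : ℂ} (N n : ℕ) (hz : ‖z‖ < 1) (h1 : (1 + ‖z‖) / 2 < ‖ζ‖) (h2 : ‖ζ‖ < 1)
    (hn : (1 - ‖z‖) / ‖ζ - z‖ ≤ 8 * Real.pi / 2 ^ n) :
    (‖ζ‖ ^ 2 - ‖z‖ ^ 2) ^ (N + 1) / (‖ζ‖ ^ N * ‖ζ - z‖ ^ (N + 2)) ≤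
      2 * 4 ^ N * (8 * Real.pi) ^ (N + 2) / (1 - ‖z‖) * (2⁻¹ ^ n) ^ (N + 2) := by
  have hz0 := norm_nonneg z
  have ha : 0 < 1 - ‖z‖ := by linarith
  have hd : 0 < ‖ζ - z‖ := by linarith [norm_sub_norm_le ζ z]
  have hζ : 2⁻¹ ≤ ‖ζ‖ := by linarith
  have hnum : ‖ζ‖ ^ 2 - ‖z‖ ^ 2 ≤ 2 * (1 - ‖z‖) := by nlinarith
  have hnum0 : 0 ≤ ‖ζ‖ ^ 2 - ‖z‖ ^ 2 := by nlinarith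
  calc (‖ζ‖ ^ 2 - ‖z‖ ^ 2) ^ (N + 1) / (‖ζ‖ ^ N * ‖ζ - z‖ ^ (N + 2))
      ≤ (2 * (1 - ‖z‖)) ^ (N + 1) / (2⁻¹ ^ N * ‖ζ - z‖ ^ (N + 2)) := by gcongr
    _ = 2 * 4 ^ N / (1 - ‖z‖) * ((1 - ‖z‖) / ‖ζ - z‖) ^ (N + 2) := by
      have h4 : (4 : ℝ) ^ N = 2 ^ N * 2 ^ N := by rw [← mul_pow]; norm_num
      rw [h4, inv_pow, mul_pow, div_pow]
      field_simp
      ring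
    _ ≤ 2 * 4 ^ N / (1 - ‖z‖) * (8 * Real.pi / 2 ^ n) ^ (N + 2) := by gcongr
    _ = _ := by rw [div_eq_mul_inv (8 * Real.pi), mul_pow, inv_pow 2 n]; ring

/-- The dyadic majorant obtained from the weighted Poisson kernel on circles. -/
def dyadicMajorant (N : ℕ) (z : ℂ) (F : ℂ → ENNReal) (ζ : ℂ) : ENNReal :=
  ∑' n : ℕ, ENNReal.ofReal (2 * 4 ^ N * (8 * Real.pi) ^ (N + 2) / (1 - ‖z‖) *
    (2⁻¹ ^ n) ^ (N + 2)) * (CBox z.arg (min (2 ^ n * (1 - ‖z‖)) (2 * Real.pi))).indicator F ζ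

lemma rpow_norm_le_lintegral_dyadicMajorant {f : ℂ → ℂ} (hf : DifferentiableOn ℂ f unitDisc)
    {z : ℂ} {α : ℝ} (hα : 0 < α) (N : ℕ) {ρ : ℝ} (hρ : ρ ∈ Ioo ((1 + ‖z‖) / 2) 1)
    (h0 : ρ ∉ norm '' ((f ⁻¹' {0}) ∩ unitDisc)) :
    ENNReal.ofReal (‖f z‖ ^ α) ≤ ∫⁻ t in Ioo (-Real.pi) Real.pi,
      dyadicMajorant N z (unitDisc.indicator fun ξ => ENNReal.ofReal (‖f ξ‖ ^ α))
        (circleMap 0 ρ t) := by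
  have hz0 := norm_nonneg z
  have hzρ : ‖z‖ < ρ := by linarith [hρ.1, hρ.2]
  have hρ0 : 0 < ρ := by linarith
  have hz : ‖z‖ < 1 := hzρ.trans hρ.2
  have hball : unitDisc = Metric.ball (0 : ℂ) 1 := by ext; simp [unitDisc]
  have hfa : AnalyticOnNhd ℂ f (Metric.closedBall 0 ρ) := by
    rw [hball] at hf
    exact (hf.analyticOnNhd Metric.isOpen_ball).mono (Metric.closedBall_subset_ball hρ.2)
  have hne : ∀ u ∈ Metric.sphere (0 : ℂ) ρ, f u ≠ 0 := by
    intro u hu hfu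
    have hu' : ‖u‖ = ρ := by simpa using hu
    exact h0 ⟨u, ⟨hfu, hu'.trans_lt hρ.2⟩, hu'⟩
  have key := rpow_norm_le_circleAverage hρ0 hα N hfa hne (w := z) (by simpa using hzρ)
  set g : ℂ → ℝ := fun ζ => ‖f ζ‖ ^ α *
    ((ρ ^ 2 - ‖z‖ ^ 2) ^ (N + 1) / (ρ ^ N * ‖ζ - z‖ ^ (N + 2))) with hg
  have hnum : 0 ≤ ρ ^ 2 - ‖z‖ ^ 2 := by nlinarith
  have hg0 (ζ : ℂ) : 0 ≤ g ζ := by positivity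
  have hgc : Continuous fun t => g (circleMap 0 ρ t) := by
    have hc : ContinuousOn g (Metric.sphere 0 ρ) := by
      have hfc : ContinuousOn f (Metric.sphere 0 ρ) :=
        hfa.continuousOn.mono Metric.sphere_subset_closedBall
      refine (hfc.norm.rpow_const fun _ _ => Or.inr hα.le).mul
        (continuousOn_const.div (by fun_prop) fun ζ hζ => ?_)
      have hζ' : ‖ζ‖ = ρ := by simpa using hζ
      have : 0 < ‖ζ - z‖ := by linarith [norm_sub_norm_le ζ z]
      positivity
    exact hc.comp_continuous (continuous_circleMap 0 ρ) fun t => circleMap_mem_sphere 0 hρ0.le t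
  have hper : Function.Periodic (fun t => g (circleMap 0 ρ t)) (2 * Real.pi) := fun t => by
    simp only [periodic_circleMap 0 ρ t]
  have hint : ∫ t in (0 : ℝ)..2 * Real.pi, g (circleMap 0 ρ t) =
      ∫ t in Ioo (-Real.pi) Real.pi, g (circleMap 0 ρ t) := by
    have := hper.intervalIntegral_add_eq 0 (-Real.pi)
    rw [zero_add] at this
    rw [this, intervalIntegral.integral_of_le (by linarith [Real.pi_pos]),
      integral_Ioc_eq_integral_Ioo]
    congr 3; ring
  rw [Real.circleAverage_def, hint, smul_eq_mul] at key
  have hI0 : 0 ≤ ∫ t in Ioo (-Real.pi) Real.pi, g (circleMap 0 ρ t) :=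
    integral_nonneg fun t => hg0 _
  have key2 : ‖f z‖ ^ α ≤ ∫ t in Ioo (-Real.pi) Real.pi, g (circleMap 0 ρ t) :=
    key.trans (mul_le_of_le_one_left hI0 (inv_le_one_of_one_le₀ (by linarith [Real.pi_gt_three])))
  refine (ENNReal.ofReal_le_ofReal key2).trans ?_
  rw [ofReal_integral_eq_lintegral_ofReal
    ((hgc.integrableOn_Icc).mono_set Ioo_subset_Icc_self) (.of_forall fun t => hg0 _)]
  refine lintegral_mono fun t => ?_
  have hζ : ‖circleMap 0 ρ t‖ = ρ := norm_circleMap_of_pos hρ0 t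
  generalize circleMap 0 ρ t = ζ at hζ
  have h1 : (1 + ‖z‖) / 2 < ‖ζ‖ := hζ ▸ hρ.1
  have h2 : ‖ζ‖ < 1 := hζ ▸ hρ.2
  obtain ⟨n, hmem, hn⟩ := exists_mem_CBox hz h1 h2
  have hk := kernel_le N n hz h1 h2 hn
  refine le_trans ?_ (ENNReal.le_tsum n)
  rw [indicator_of_mem hmem, indicator_of_mem (show ζ ∈ unitDisc from h2),
    ← ENNReal.ofReal_mul (by have := sub_pos.2 hz; positivity)]
  refine ENNReal.ofReal_le_ofReal ?_
  rw [hζ] at hk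
  calc g ζ ≤ _ := mul_le_mul_of_nonneg_left hk (by positivity)
    _ = _ := mul_comm _ _

section MaximalFunction

variable {ω : ℝ → ℝ}

lemma setLIntegral_CBox_min_le (h : IsRadialContinuousWeight ω) {W : ℝ → ENNReal}
    (hW : Measurable W) (hWω : ∀ x ∈ Ico (0 : ℝ) 1, W x = ENNReal.ofReal (ω x)) {p : ℕ}
    (hp : ∀ u s : ℝ, 0 ≤ u → u ≤ s → s < 1 → wInt ω u * (1 - s) ^ p ≤ wInt ω s * (1 - u) ^ p)
    (θ : ℝ) {a : ℝ} (ha : 0 < a) (ha1 : a ≤ 1) (n : ℕ) :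
    ∫⁻ ξ in CBox θ (min (2 ^ n * a) (2 * Real.pi)), ENNReal.ofReal (ω ‖ξ‖) ≤
      ENNReal.ofReal (2 ^ n * a * ((2 ^ (n + 1)) ^ p * wInt ω (1 - a / 2))) := by
  have h2n : (1 : ℝ) ≤ 2 ^ n := one_le_pow₀ one_le_two
  have hna : a ≤ 2 ^ n * a := le_mul_of_one_le_left ha.le h2n
  set s := max 0 (1 - 2 ^ n * a) with hs
  have hs0 : 0 ≤ s := le_max_left _ _
  have hs1 : s < 1 := max_lt one_pos (by linarith)
  have hss : s ≤ 1 - a / 2 := max_le (by linarith) (by linarith)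
  have hs' : s = max 0 (1 - min (2 ^ n * a) (2 * Real.pi)) := by
    rcases le_total (2 ^ n * a) (2 * Real.pi) with hle | hle
    · rw [min_eq_left hle]
    · rw [min_eq_right hle, hs, max_eq_left, max_eq_left] <;> linarith [Real.pi_gt_three]
  have hcongr : ∫⁻ ξ in CBox θ (min (2 ^ n * a) (2 * Real.pi)), ENNReal.ofReal (ω ‖ξ‖) =
      ∫⁻ ξ in CBox θ (min (2 ^ n * a) (2 * Real.pi)), W ‖ξ‖ :=
    setLIntegral_congr_fun (measurableSet_CBox _ _)
      fun ξ hξ => (hWω _ ⟨norm_nonneg _, hξ.2.1⟩).symm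
  rw [hcongr]
  refine (setLIntegral_CBox_le hW (fun x hx => hWω x (Ioo_subset_Ico_self hx)) θ hs').trans ?_
  rw [h.1.lintegral_Ioo_eq ⟨hs0, hs1⟩, ENNReal.ofReal_mul (by positivity)]
  gcongr
  · exact min_le_left _ _
  have hw := h.1.wInt_pos (r := 1 - a / 2) ⟨by linarith, by linarith⟩
  have key := hp s (1 - a / 2) hs0 hss (by linarith)
  have hle : 1 - s ≤ 2 ^ (n + 1) * (1 - (1 - a / 2)) := by
    have : 1 - 2 ^ n * a ≤ s := le_max_right _ _
    rw [pow_succ]; linarith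
  have hpos : 0 < (1 - (1 - a / 2)) ^ p := pow_pos (by linarith) p
  refine le_of_mul_le_mul_right ?_ hpos
  calc wInt ω s * (1 - (1 - a / 2)) ^ p ≤ wInt ω (1 - a / 2) * (1 - s) ^ p := key
    _ ≤ wInt ω (1 - a / 2) * (2 ^ (n + 1) * (1 - (1 - a / 2))) ^ p := by
      have : 0 ≤ 1 - s := by linarith
      gcongr
    _ = _ := by rw [mul_pow]; ring

lemma le_lintegral_mul_dyadicMajorant (h : IsRadialContinuousWeight ω) {W : ℝ → ENNReal}
    (hW : Measurable W) (hWω : ∀ x ∈ Ico (0 : ℝ) 1, W x = ENNReal.ofReal (ω x)) {f : ℂ → ℂ}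
    (hf : DifferentiableOn ℂ f unitDisc) {z : ℂ} (hz : z ∈ unitDisc) (hfz : f z ≠ 0) {α : ℝ}
    (hα : 0 < α) (N : ℕ)
    (hF : Measurable (unitDisc.indicator fun ξ => ENNReal.ofReal (‖f ξ‖ ^ α))) :
    ENNReal.ofReal (‖f z‖ ^ α) * ENNReal.ofReal (2⁻¹ * wInt ω ((1 + ‖z‖) / 2)) ≤
      ∫⁻ ζ, W ‖ζ‖ *
        dyadicMajorant N z (unitDisc.indicator fun ξ => ENNReal.ofReal (‖f ξ‖ ^ α)) ζ := by
  have hz0 := norm_nonneg z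
  have hz1 : ‖z‖ < 1 := hz
  set D := dyadicMajorant N z (unitDisc.indicator fun ξ => ENNReal.ofReal (‖f ξ‖ ^ α)) with hD
  have hDm : Measurable D := by
    refine Measurable.tsum fun n => ?_
    exact (hF.indicator (measurableSet_CBox _ _)).const_mul _
  have hpt : ∀ᵐ ρ ∂(volume.restrict (Ioo ((1 + ‖z‖) / 2) 1)),
      ENNReal.ofReal (‖f z‖ ^ α) * (ENNReal.ofReal 2⁻¹ * ENNReal.ofReal (ω ρ)) ≤
      ∫⁻ t in Ioo (-Real.pi) Real.pi, ENNReal.ofReal ρ *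
        (W ‖circleMap 0 ρ t‖ * D (circleMap 0 ρ t)) := by
    filter_upwards [ae_restrict_mem measurableSet_Ioo,
      ae_restrict_of_ae ((countable_norm_image_zeros hf hz hfz).ae_notMem volume)] with ρ hρ hρ0
    have hρp : 0 < ρ := by linarith [hρ.1]
    simp_rw [norm_circleMap_of_pos hρp, hWω ρ ⟨hρp.le, hρ.2⟩, ← mul_assoc]
    rw [lintegral_const_mul' _ _ (by finiteness), mul_assoc, mul_comm]
    have h2 : ENNReal.ofReal 2⁻¹ ≤ ENNReal.ofReal ρ :=
      ENNReal.ofReal_le_ofReal (by linarith [hρ.1])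
    exact mul_le_mul' (mul_le_mul' h2 le_rfl)
      (rpow_norm_le_lintegral_dyadicMajorant hf hα N hρ hρ0)
  rw [lintegral_eq_lintegral_circleMap (g := fun ζ => W ‖ζ‖ * D ζ)
    ((hW.comp measurable_norm).mul hDm)]
  refine le_trans ?_ (lintegral_mono_set (s := Ioo ((1 + ‖z‖) / 2) 1)
    fun x hx => (by linarith [hx.1] : (0 : ℝ) < x))
  refine le_trans (le_of_eq ?_) (lintegral_mono_ae hpt)
  rw [lintegral_const_mul' _ _ (by finiteness), lintegral_const_mul' _ _ (by finiteness),
    h.1.lintegral_Ioo_eq ⟨by linarith, by linarith⟩, ENNReal.ofReal_mul (by positivity)]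

lemma lintegral_mul_dyadicMajorant {W : ℝ → ENNReal}
    (hW : Measurable W) (hWω : ∀ x ∈ Ico (0 : ℝ) 1, W x = ENNReal.ofReal (ω x)) {f : ℂ → ℂ}
    (z : ℂ) {α : ℝ} (N : ℕ)
    (hF : Measurable (unitDisc.indicator fun ξ => ENNReal.ofReal (‖f ξ‖ ^ α))) :
    ∫⁻ ζ, W ‖ζ‖ *
        dyadicMajorant N z (unitDisc.indicator fun ξ => ENNReal.ofReal (‖f ξ‖ ^ α)) ζ =
      ∑' n : ℕ, ENNReal.ofReal (2 * 4 ^ N * (8 * Real.pi) ^ (N + 2) / (1 - ‖z‖) *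
        (2⁻¹ ^ n) ^ (N + 2)) * ∫⁻ ξ in CBox z.arg (min (2 ^ n * (1 - ‖z‖)) (2 * Real.pi)),
          ENNReal.ofReal (|‖f ξ‖ ^ α| * ω ‖ξ‖) := by
  simp_rw [dyadicMajorant, ← ENNReal.tsum_mul_left]
  have hWn : Measurable fun ζ : ℂ => W ‖ζ‖ := hW.comp measurable_norm
  rw [lintegral_tsum]
  swap
  · exact fun n => (hWn.mul ((hF.indicator (measurableSet_CBox _ _)).const_mul _)).aemeasurable
  refine tsum_congr fun n => ?_
  simp_rw [mul_left_comm (W _)]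
  rw [lintegral_const_mul' _ _ (by finiteness), ← lintegral_indicator (measurableSet_CBox _ _)]
  congr 1
  refine lintegral_congr fun ζ => ?_
  by_cases hζ : ζ ∈ CBox z.arg (min (2 ^ n * (1 - ‖z‖)) (2 * Real.pi))
  · rw [indicator_of_mem hζ, indicator_of_mem hζ,
      indicator_of_mem (show ζ ∈ unitDisc from hζ.2.1), hWω _ ⟨norm_nonneg _, hζ.2.1⟩,
      abs_of_nonneg (by positivity), ENNReal.ofReal_mul (by positivity), mul_comm]
  · rw [indicator_of_notMem hζ, indicator_of_notMem hζ, mul_zero]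

lemma mem_CBox_arg {z : ℂ} (hz : ‖z‖ < 1) {h : ℝ} (h0 : 0 ≤ h) (hh : 1 - ‖z‖ ≤ h) :
    z ∈ CBox z.arg h := by
  refine ⟨by linarith, hz, ?_⟩
  have : z * Complex.exp (-(z.arg : ℂ) * Complex.I) = ‖z‖ := by
    calc _ = ‖z‖ * Complex.exp (z.arg * Complex.I) *
          Complex.exp (-(z.arg : ℂ) * Complex.I) := by rw [Complex.norm_mul_exp_arg_mul_I]
      _ = _ := by rw [mul_assoc, ← Complex.exp_add]; simp
  rw [this, Complex.arg_ofReal_of_nonneg (norm_nonneg z), abs_zero]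
  positivity

lemma IsRadialContinuousWeight.measurable_indicator (h : IsRadialContinuousWeight ω) :
    Measurable ((Ico (0 : ℝ) 1).indicator fun x => ENNReal.ofReal (ω x)) := by
  classical
  rw [← piecewise_eq_indicator]
  exact (ENNReal.continuous_ofReal.comp_continuousOn h.2).measurable_piecewise
    continuousOn_const measurableSet_Ico

lemma measurable_indicator_unitDisc {f : ℂ → ℂ} (hf : DifferentiableOn ℂ f unitDisc) {α : ℝ}
    (hα : 0 < α) :
    Measurable (unitDisc.indicator fun ξ => ENNReal.ofReal (‖f ξ‖ ^ α)) := by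
  classical
  rw [← piecewise_eq_indicator]
  exact (ENNReal.continuous_ofReal.comp_continuousOn
    (hf.continuousOn.norm.rpow_const fun _ _ => Or.inr hα.le)).measurable_piecewise
    continuousOn_const (measurableSet_lt measurable_norm measurable_const)

end MaximalFunction

theorem stmt7 (α : ℝ) (hα : 0 < α) (ω : ℝ → ℝ)
    (hω : IsRegularWeight ω ∨ IsRapidlyIncreasing ω) :
    ∃ C : ℝ, 0 < C ∧ ∀ f : ℂ → ℂ, DifferentiableOn ℂ f unitDisc →
      ∀ z ∈ unitDisc,
        ENNReal.ofReal (‖f z‖ ^ α) ≤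
          ENNReal.ofReal C * MaxFn ω (fun ξ => ‖f ξ‖ ^ α) z := by
  obtain ⟨h, -⟩ := exists_mul_le_wInt hω
  obtain ⟨p, hp⟩ := exists_wInt_mul_pow_le hω
  set K : ℝ := 2 * 4 ^ p * (8 * Real.pi) ^ (p + 2) with hK
  have hK0 : 0 < K := by have := Real.pi_pos; positivity
  refine ⟨K * 2 ^ p * 2 * 2, by positivity, fun f hf z hz => ?_⟩
  have hz1 : ‖z‖ < 1 := hz
  have hz0 := norm_nonneg z
  by_cases hfz : f z = 0
  · simp [hfz, Real.zero_rpow hα.ne']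
  set M := MaxFn ω (fun ξ => ‖f ξ‖ ^ α) z with hM
  by_cases hMt : M = ⊤
  · rw [hMt, ENNReal.mul_top (ENNReal.ofReal_pos.2 (by positivity)).ne']
    exact le_top
  set W : ℝ → ENNReal := (Ico (0 : ℝ) 1).indicator fun x => ENNReal.ofReal (ω x) with hWdef
  have hW : Measurable W := h.measurable_indicator
  have hWω : ∀ x ∈ Ico (0 : ℝ) 1, W x = ENNReal.ofReal (ω x) := fun x hx => indicator_of_mem hx _
  have hF := measurable_indicator_unitDisc hf hα
  set a := 1 - ‖z‖ with ha
  have ha0 : 0 < a := by linarith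
  set w := wInt ω ((1 + ‖z‖) / 2) with hw
  have hw0 : 0 < w := h.1.wInt_pos ⟨by linarith, by linarith⟩
  have hwa : wInt ω (1 - a / 2) = w := by rw [hw]; congr 1; rw [ha]; ring
  have hbox (n : ℕ) : ∫⁻ ξ in CBox z.arg (min (2 ^ n * a) (2 * Real.pi)),
      ENNReal.ofReal (|‖f ξ‖ ^ α| * ω ‖ξ‖) ≤
      M * ENNReal.ofReal (2 ^ n * a * ((2 ^ (n + 1)) ^ p * w)) := by
    have hvol := setLIntegral_CBox_min_le h hW hWω hp z.arg ha0 (by linarith) n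
    rw [hwa] at hvol
    have hmin : a ≤ min (2 ^ n * a) (2 * Real.pi) :=
      le_min (le_mul_of_one_le_left ha0.le (one_le_pow₀ one_le_two))
        (by linarith [Real.pi_gt_three])
    have hle := le_iSup_of_le (f := fun θ : ℝ => ⨆ (h : ℝ)
      (_ : 0 < h ∧ h ≤ 2 * Real.pi ∧ z ∈ CBox θ h),
      (∫⁻ ξ in CBox θ h, ENNReal.ofReal (|‖f ξ‖ ^ α| * ω ‖ξ‖)) /
      (∫⁻ ξ in CBox θ h, ENNReal.ofReal (ω ‖ξ‖))) z.arg
      (le_iSup₂_of_le (min (2 ^ n * a) (2 * Real.pi)) ⟨ha0.trans_le hmin, min_le_right _ _,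
        mem_CBox_arg hz1 (ha0.le.trans hmin) hmin⟩ le_rfl)
    have hle' : _ ≤ M := hle
    refine le_trans ?_ (mul_le_mul' le_rfl hvol)
    exact (ENNReal.div_le_iff_le_mul (Or.inr hMt)
      (Or.inl (ne_top_of_le_ne_top ENNReal.ofReal_ne_top hvol))).1 hle'
  have hsum := (le_lintegral_mul_dyadicMajorant h hW hWω hf hz hfz hα p hF).trans_eq
    (lintegral_mul_dyadicMajorant hW hWω z p hF)
  have hterm (n : ℕ) : ENNReal.ofReal (K / a * (2⁻¹ ^ n) ^ (p + 2)) *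
      ∫⁻ ξ in CBox z.arg (min (2 ^ n * a) (2 * Real.pi)),
        ENNReal.ofReal (|‖f ξ‖ ^ α| * ω ‖ξ‖) ≤
      M * ENNReal.ofReal (K * 2 ^ p * w) * 2⁻¹ ^ n := by
    refine (mul_le_mul' le_rfl (hbox n)).trans_eq ?_
    rw [mul_left_comm, ← ENNReal.ofReal_mul (by positivity), mul_assoc M]
    have h2 : (2⁻¹ : ENNReal) ^ n = ENNReal.ofReal (2⁻¹ ^ n) := by
      rw [ENNReal.ofReal_pow (by positivity), ENNReal.ofReal_inv_of_pos two_pos,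
        ENNReal.ofReal_ofNat]
    rw [h2, ← ENNReal.ofReal_mul (by positivity)]
    congr 2
    have h3 : (2⁻¹ ^ n : ℝ) ^ (p + 2) * (2 ^ n) ^ (p + 1) = 2⁻¹ ^ n := by
      rw [pow_succ, mul_right_comm, ← mul_pow, ← mul_pow]; norm_num
    calc K / a * (2⁻¹ ^ n) ^ (p + 2) * (2 ^ n * a * ((2 ^ (n + 1)) ^ p * w))
        = K * 2 ^ p * w * ((2⁻¹ ^ n) ^ (p + 2) * (2 ^ n) ^ (p + 1)) * (a / a) := by
          rw [pow_succ (2 : ℝ) n, mul_pow]; ring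
      _ = _ := by rw [h3, div_self ha0.ne', mul_one]
  have htot := hsum.trans (ENNReal.tsum_le_tsum hterm)
  rw [ENNReal.tsum_mul_left, ENNReal.tsum_geometric, ENNReal.one_sub_inv_two, inv_inv] at htot
  have hc0 : ENNReal.ofReal (2⁻¹ * w) ≠ 0 := (ENNReal.ofReal_pos.2 (by positivity)).ne'
  refine (ENNReal.mul_le_mul_iff_left hc0 ENNReal.ofReal_ne_top).1 (htot.trans_eq ?_)
  rw [mul_comm (ENNReal.ofReal (K * 2 ^ p * 2 * 2)), mul_assoc M, mul_assoc M,
    ← ENNReal.ofReal_mul (by positivity), ← ENNReal.ofReal_ofNat, ← ENNReal.ofReal_mul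
      (by positivity)]
  congr 2; ring
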